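/- arXiv:1905.02118 — 7 statements merged into one kernel-verified Lean document; each statement's English description precedes it below -/
import Mathlib

section
/- For finite abstract simplicial complexes G and H on disjoint vertex sets, the average simplex cardinality is additive under the join: Dim⁺(G ⊕ H) = Dim⁺(G) + Dim⁺(H). -/
/-- A finite abstract simplicial complex: a finite collection of nonempty finite
subsets of the vertex type `V`, closed under taking nonempty subsets. -/
def IsComplex {V : Type*} [DecidableEq V] (G : Finset (Finset V)) : Prop :=
  (∀ x ∈ G, x.Nonempty) ∧ ∀ x ∈ G, ∀ y ⊆ x, y.Nonempty → y ∈ G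

/-- The join `G ⊕ H` of two simplicial complexes. -/
def joinC {V : Type*} [DecidableEq V] (G H : Finset (Finset V)) : Finset (Finset V) :=
  G ∪ H ∪ (G ×ˢ H).image fun p => p.1 ∪ p.2

/-- The average simplex cardinality `Dim⁺(G) = (∑_{x ∈ G} |x|) / (|G| + 1)`. -/
def DimPlus {V : Type*} [DecidableEq V] (G : Finset (Finset V)) : ℚ :=
  (∑ x ∈ G, (x.card : ℚ)) / (G.card + 1)

/-- If every member of `G` is disjoint from every member of `H`, then `(x, y) ↦ x ∪ y` is
injective on `G × H`. -/
theorem injOn_union_of_forall_disjoint {V : Type*} [DecidableEq V] {G H : Finset (Finset V)}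
    (hdisj : ∀ x ∈ G, ∀ y ∈ H, Disjoint x y) :
    Set.InjOn (fun p : Finset V × Finset V => p.1 ∪ p.2) (G ×ˢ H : Finset _) := by
  rintro ⟨x, y⟩ hp ⟨x', y'⟩ hq h
  simp only [Finset.coe_product, Set.mem_prod, Finset.mem_coe] at hp hq h
  have key (v : V) : (v ∈ x ↔ v ∈ x') ∧ (v ∈ y ↔ v ∈ y') := by
    have h₁ : v ∈ x ∪ y ↔ v ∈ x' ∪ y' := by rw [h]
    have h₂ : v ∈ x → v ∉ y' := fun hv => Finset.disjoint_left.mp (hdisj x hp.1 y' hq.2) hv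
    have h₃ : v ∈ x' → v ∉ y := fun hv => Finset.disjoint_left.mp (hdisj x' hq.1 y hp.2) hv
    simp only [Finset.mem_union] at h₁
    tauto
  exact Prod.ext (Finset.ext fun v => (key v).1) (Finset.ext fun v => (key v).2)

/-- A sum over the join splits into the sums over the two complexes and over the joined pairs. -/
theorem sum_joinC {V M : Type*} [DecidableEq V] [AddCommMonoid M] {G H : Finset (Finset V)}
    (hG : ∀ x ∈ G, x.Nonempty) (hH : ∀ y ∈ H, y.Nonempty)
    (hdisj : ∀ x ∈ G, ∀ y ∈ H, Disjoint x y) (f : Finset V → M) :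
    ∑ z ∈ joinC G H, f z =
      ∑ x ∈ G, f x + ∑ y ∈ H, f y + ∑ x ∈ G, ∑ y ∈ H, f (x ∪ y) := by
  have hGH : Disjoint G H := Finset.disjoint_left.mpr fun x hx hx' =>
    (hG x hx).ne_empty (disjoint_self.mp (hdisj x hx x hx'))
  have hjoin : Disjoint (G ∪ H) ((G ×ˢ H).image fun p => p.1 ∪ p.2) := by
    rw [Finset.disjoint_right]
    intro z hz hz'
    obtain ⟨⟨x, y⟩, hp, rfl⟩ := Finset.mem_image.mp hz
    obtain ⟨hx, hy⟩ := Finset.mem_product.mp hp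
    rcases Finset.mem_union.mp hz' with h | h
    · exact (hH y hy).ne_empty
        (disjoint_self.mp ((hdisj _ h y hy).mono_left Finset.subset_union_right))
    · exact (hG x hx).ne_empty
        (disjoint_self.mp ((hdisj x hx _ h).mono_right Finset.subset_union_left))
  rw [joinC, Finset.sum_union hjoin, Finset.sum_union hGH,
    Finset.sum_image (injOn_union_of_forall_disjoint hdisj), Finset.sum_product]

/-- The average simplex cardinality is additive under the join of simplicial
complexes on disjoint vertex sets: `Dim⁺(G ⊕ H) = Dim⁺(G) + Dim⁺(H)`. -/
theorem DimPlus_joinC {V : Type*} [DecidableEq V] (G H : Finset (Finset V))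
    (hG : IsComplex G) (hH : IsComplex H)
    (hdisj : ∀ x ∈ G, ∀ y ∈ H, Disjoint x y) :
    DimPlus (joinC G H) = DimPlus G + DimPlus H := by
  have hcard : ((joinC G H).card : ℚ) = G.card + H.card + G.card * H.card := by
    simpa using sum_joinC hG.1 hH.1 hdisj fun _ => (1 : ℚ)
  have hpairs : ∑ x ∈ G, ∑ y ∈ H, ((x ∪ y).card : ℚ) =
      H.card * ∑ x ∈ G, (x.card : ℚ) + G.card * ∑ y ∈ H, (y.card : ℚ) := by
    have h : ∑ x ∈ G, ∑ y ∈ H, ((x ∪ y).card : ℚ) =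
        ∑ x ∈ G, ∑ y ∈ H, ((x.card : ℚ) + y.card) :=
      Finset.sum_congr rfl fun x hx => Finset.sum_congr rfl fun y hy => by
        rw [Finset.card_union_of_disjoint (hdisj x hx y hy), Nat.cast_add]
    rw [h]
    simp [Finset.sum_add_distrib, Finset.mul_sum]
  have hG₀ : (G.card : ℚ) + 1 ≠ 0 := by positivity
  have hH₀ : (H.card : ℚ) + 1 ≠ 0 := by positivity
  have hfactor : (G.card : ℚ) + H.card + G.card * H.card + 1 = (G.card + 1) * (H.card + 1) := by
    ring
  rw [DimPlus, DimPlus, DimPlus, sum_joinC hG.1 hH.1 hdisj, hcard, hpairs, hfactor,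
    div_add_div _ _ hG₀ hH₀]
  ring
end

section
/- Let G be a finite abstract simplicial complex and let C = G ⊕ P be the cone over G, the join of G with a one-point complex P whose vertex does not occur in G. Then f_C(t) = (1+t)·f_G(t) as polynomials, and Dim⁺(C) = Dim⁺(G) + 1/2. -/
/-- The simplex generating function `f_G(t) = 1 + v₀ t + v₁ t² + ⋯ + v_d t^{d+1}`,
written as `1 + ∑_{x ∈ G} t^{|x|}`. -/
noncomputable def genFun {V : Type*} [DecidableEq V] (G : Finset (Finset V)) : Polynomial ℚ :=
  1 + ∑ x ∈ G, Polynomial.X ^ x.card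

/-- A sum over a cone splits into the base, the cone point, and the simplices of the base
with the cone point added. -/
theorem sum_joinC_singleton {V M : Type*} [DecidableEq V] [AddCommMonoid M]
    {G : Finset (Finset V)} (hne : ∀ x ∈ G, x.Nonempty) {p : V} (hp : ∀ x ∈ G, p ∉ x)
    (f : ℕ → M) :
    ∑ x ∈ joinC G {{p}}, f x.card = ∑ x ∈ G, f x.card + f 1 + ∑ x ∈ G, f (x.card + 1) := by
  have himage : (G ×ˢ {{p}}).image (fun q : Finset V × Finset V => q.1 ∪ q.2)
      = G.image (insert p) := by
    ext y
    simp
  have hinj : Set.InjOn (insert p : Finset V → Finset V) G := fun x hx y hy hxy => by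
    rw [← Finset.erase_insert (hp x hx), hxy, Finset.erase_insert (hp y hy)]
  have hbase : Disjoint G {{p}} :=
    Finset.disjoint_singleton_right.2 fun h => hp _ h (Finset.mem_singleton_self p)
  have hcone : Disjoint (G ∪ {{p}}) (G.image (insert p)) := by
    rw [Finset.disjoint_right]
    intro y hy hy'
    obtain ⟨x, hx, rfl⟩ := Finset.mem_image.1 hy
    rcases Finset.mem_union.1 hy' with h | h
    · exact hp _ h (Finset.mem_insert_self p x)
    · obtain ⟨v, hv⟩ := hne x hx
      have hvp : v ∈ ({p} : Finset V) :=
        Finset.mem_singleton.1 h ▸ Finset.mem_insert_of_mem hv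
      exact hp x hx (Finset.mem_singleton.1 hvp ▸ hv)
  rw [joinC, himage, Finset.sum_union hcone, Finset.sum_union hbase, Finset.sum_image hinj,
    Finset.sum_singleton, Finset.card_singleton]
  congr 1
  exact Finset.sum_congr rfl fun x hx => by rw [Finset.card_insert_of_notMem (hp x hx)]

/-- For the cone `C = G ⊕ {{p}}` over a complex `G`, with cone point `p` not a
vertex of `G`, one has `f_C(t) = (1+t)·f_G(t)` and `Dim⁺(C) = Dim⁺(G) + 1/2`. -/
theorem cone_genFun_DimPlus {V : Type*} [DecidableEq V] (G : Finset (Finset V))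
    (hG : IsComplex G) (p : V) (hp : ∀ x ∈ G, p ∉ x) :
    genFun (joinC G {{p}}) = (1 + Polynomial.X) * genFun G ∧
    DimPlus (joinC G {{p}}) = DimPlus G + 1 / 2 := by
  constructor
  · rw [genFun, genFun, sum_joinC_singleton hG.1 hp (fun n => (Polynomial.X : Polynomial ℚ) ^ n)]
    simp only [pow_succ, ← Finset.sum_mul]
    ring
  · have hcard : ((joinC G {{p}}).card : ℚ) = G.card + 1 + G.card := by
      simpa using sum_joinC_singleton hG.1 hp (fun _ => (1 : ℚ))
    have hsum := sum_joinC_singleton hG.1 hp (fun n => (n : ℚ))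
    simp only [Nat.cast_add, Nat.cast_one, Finset.sum_add_distrib, Finset.sum_const,
      nsmul_eq_mul, mul_one] at hsum
    have hpos : (G.card : ℚ) + 1 ≠ 0 := by positivity
    rw [DimPlus, DimPlus, hcard, hsum,
      show (G.card : ℚ) + 1 + G.card + 1 = 2 * (G.card + 1) by ring]
    field_simp
    ring
end

section
/- For every n ≥ 1, the complete complex K_n satisfies Dim⁺(K_n) = n/2 and dim(K_n) = n − 1; in particular Dim⁺(K_n) = (dim(K_n)+1)/2. -/
/-- The unit sphere `S(x) = {y ∈ G : y ⊊ x or x ⊊ y}` of `x` in `G`. -/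
def sphere {V : Type*} [DecidableEq V] (G : Finset (Finset V)) (x : Finset V) :
    Finset (Finset V) :=
  G.filter fun y => y ⊂ x ∨ x ⊂ y

/-- The inductive dimension: `dim ∅ = -1` and
`dim G = 1 + (1/|G|)·∑_{x ∈ G} dim (S(x))` for nonempty `G`. -/
def indDim {V : Type*} [DecidableEq V] (G : Finset (Finset V)) : ℚ :=
  if G.Nonempty then
    1 + (∑ x ∈ G.attach, indDim (sphere G x.1)) / G.card
  else -1
termination_by G.card
decreasing_by
  refine Finset.card_lt_card ⟨Finset.filter_subset _ _, fun hsub => ?_⟩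
  have h := hsub x.2
  simp only [sphere, Finset.mem_filter] at h
  rcases h.2 with h' | h' <;> exact ssubset_irrefl _ h'

theorem card_mul_indDim_add_one {V : Type*} [DecidableEq V] (G : Finset (Finset V)) :
    (G.card : ℚ) * (indDim G + 1) = G.card + ∑ x ∈ G, (indDim (sphere G x) + 1) := by
  rcases G.eq_empty_or_nonempty with rfl | hG
  · simp
  · have hc : (G.card : ℚ) ≠ 0 := by exact_mod_cast hG.card_pos.ne'
    rw [indDim, if_pos hG, Finset.sum_attach G fun x => indDim (sphere G x),
      Finset.sum_add_distrib]
    simp only [Finset.sum_const, nsmul_eq_mul, mul_one]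
    field_simp
    ring

theorem indDim_empty {V : Type*} [DecidableEq V] :
    indDim (∅ : Finset (Finset V)) = -1 := by
  rw [indDim]
  simp

theorem indDim_singleton {V : Type*} [DecidableEq V] (x : Finset V) :
    indDim ({x} : Finset (Finset V)) = 0 := by
  have h := card_mul_indDim_add_one ({x} : Finset (Finset V))
  have hs : sphere {x} x = ∅ := by
    simp [sphere]
  simpa [hs, indDim_empty] using h

theorem card_sphere_lt {V : Type*} [DecidableEq V] {G : Finset (Finset V)} {x : Finset V}
    (hx : x ∈ G) : (sphere G x).card < G.card :=
  Finset.card_lt_card (Finset.filter_ssubset.2 ⟨x, hx, by simp⟩)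

/-- The quantity `dim + 1` is additive under joins. -/
theorem indDim_union_add_one {V : Type*} [DecidableEq V] (A B : Finset (Finset V))
    (hAB : ∀ a ∈ A, ∀ b ∈ B, a ⊂ b) :
    indDim (A ∪ B) + 1 = (indDim A + 1) + (indDim B + 1) := by
  induction hm : A.card + B.card using Nat.strong_induction_on generalizing A B with
  | _ m ih =>
  subst hm
  have hd : Disjoint A B :=
    Finset.disjoint_left.2 fun x hA hB => ssubset_irrefl x (hAB x hA x hB)
  have hsA : ∀ x ∈ A, indDim (sphere (A ∪ B) x) + 1
      = (indDim (sphere A x) + 1) + (indDim B + 1) := by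
    intro x hx
    have he : sphere (A ∪ B) x = sphere A x ∪ B := by
      rw [sphere, Finset.filter_union, sphere,
        Finset.filter_true_of_mem (s := B) fun y hy => Or.inr (hAB x hx y hy)]
    rw [he]
    refine ih _ ?_ _ _ (fun a ha => hAB a (Finset.mem_filter.1 ha).1) rfl
    exact Nat.add_lt_add_right (card_sphere_lt hx) _
  have hsB : ∀ x ∈ B, indDim (sphere (A ∪ B) x) + 1
      = (indDim A + 1) + (indDim (sphere B x) + 1) := by
    intro x hx
    have he : sphere (A ∪ B) x = A ∪ sphere B x := by
      rw [sphere, Finset.filter_union, sphere,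
        Finset.filter_true_of_mem (s := A) fun y hy => Or.inl (hAB y hy x hx)]
    rw [he]
    refine ih _ ?_ _ _ (fun a ha b hb => hAB a ha b (Finset.mem_filter.1 hb).1) rfl
    exact Nat.add_lt_add_left (card_sphere_lt hx) _
  rcases (A ∪ B).eq_empty_or_nonempty with h0 | hne
  · obtain ⟨rfl, rfl⟩ := Finset.union_eq_empty.1 h0
    simp [indDim_empty]
  have hc : ((A ∪ B).card : ℚ) ≠ 0 := by exact_mod_cast hne.card_pos.ne'
  have h := card_mul_indDim_add_one (A ∪ B)
  rw [Finset.sum_union hd, Finset.sum_congr rfl hsA, Finset.sum_congr rfl hsB] at h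
  have hA := card_mul_indDim_add_one A
  have hB := card_mul_indDim_add_one B
  simp only [Finset.sum_add_distrib, Finset.sum_const, nsmul_eq_mul] at h hA hB
  apply mul_left_cancel₀ hc
  rw [h, Finset.card_union_of_disjoint hd]
  push_cast
  linear_combination -hA - hB

theorem indDim_Ioo {V : Type*} [DecidableEq V] {a b : Finset V} (hab : a < b) :
    indDim (Finset.Ioo a b) = indDim (Finset.Ioc a b) - 1 := by
  have h := indDim_union_add_one (Finset.Ioo a b) {b} (by
    intro x hx y hy
    rw [Finset.mem_singleton.1 hy]
    exact (Finset.mem_Ioo.1 hx).2)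
  have he : Finset.Ioo a b ∪ {b} = Finset.Ioc a b := by
    rw [Finset.union_comm, ← Finset.insert_eq, Finset.Ioo_insert_right hab]
  rw [he, indDim_singleton] at h
  linarith

theorem indDim_sphere_Ioc {V : Type*} [DecidableEq V] {a b x : Finset V}
    (hx : x ∈ Finset.Ioc a b) :
    indDim (sphere (Finset.Ioc a b) x) + 1
      = indDim (Finset.Ioc a x) + (indDim (Finset.Ioc x b) + 1) := by
  obtain ⟨hax, hxb⟩ := Finset.mem_Ioc.1 hx
  have he : sphere (Finset.Ioc a b) x = Finset.Ioo a x ∪ Finset.Ioc x b := by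
    ext y
    simp only [sphere, Finset.mem_filter, Finset.mem_union, Finset.mem_Ioc, Finset.mem_Ioo]
    constructor
    · rintro ⟨⟨h₁, h₂⟩, h | h⟩
      · exact Or.inl ⟨h₁, h⟩
      · exact Or.inr ⟨h, h₂⟩
    · rintro (⟨h₁, h₂⟩ | ⟨h₁, h₂⟩)
      · exact ⟨⟨h₁, h₂.le.trans hxb⟩, Or.inl h₂⟩
      · exact ⟨⟨hax.trans h₁, h₂⟩, Or.inr h₁⟩
  rw [he, indDim_union_add_one, indDim_Ioo hax]
  · ring
  · intro u hu v hv
    exact (Finset.mem_Ioo.1 hu).2.trans (Finset.mem_Ioc.1 hv).1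

theorem indDim_Ioc {V : Type*} [DecidableEq V] {a b : Finset V} (hab : a ≤ b) :
    indDim (Finset.Ioc a b) = (b.card : ℚ) - a.card - 1 := by
  induction hm : b.card - a.card using Nat.strong_induction_on generalizing a b with
  | _ m ih =>
  subst hm
  rcases hab.eq_or_lt with rfl | hlt
  · simp [indDim_empty]
  have hsum : ∀ x ∈ Finset.Ioo a b, indDim (sphere (Finset.Ioc a b) x) + 1
      = (b.card : ℚ) - a.card - 1 := by
    intro x hx
    obtain ⟨hax, hxb⟩ := Finset.mem_Ioo.1 hx
    have h₁ := Finset.card_lt_card hax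
    have h₂ := Finset.card_lt_card hxb
    rw [indDim_sphere_Ioc (Finset.Ioo_subset_Ioc_self hx), ih _ (by omega) hax.le rfl,
      ih _ (by omega) hxb.le rfl]
    ring
  have h := card_mul_indDim_add_one (Finset.Ioc a b)
  rw [← Finset.Ioo_insert_right hlt, Finset.sum_insert Finset.right_notMem_Ioo,
    Finset.card_insert_of_notMem Finset.right_notMem_Ioo, Finset.Ioo_insert_right hlt,
    Finset.sum_congr rfl hsum, indDim_sphere_Ioc (Finset.right_mem_Ioc.2 hlt),
    Finset.Ioc_self, indDim_empty, Finset.sum_const, nsmul_eq_mul] at h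
  push_cast at h
  rcases (Finset.Ioo a b).eq_empty_or_nonempty with h0 | hne
  · have hcov : a ⋖ b := ⟨hlt, fun c h₁ h₂ => by
      simpa [h0] using Finset.mem_Ioo.2 ⟨h₁, h₂⟩⟩
    have hcard : b.card = a.card + 1 := (Finset.covBy_iff_card_sdiff_eq_one.1 hcov).elim
      fun h₁ h₂ => by rw [Finset.card_sdiff_of_subset h₁] at h₂; omega
    rw [← Finset.Ioo_insert_right hlt, h0, hcard]
    simp [indDim_singleton]
  · have hc : ((Finset.Ioo a b).card : ℚ) ≠ 0 := by exact_mod_cast hne.card_pos.ne'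
    apply mul_left_cancel₀ hc
    linear_combination h

theorem two_mul_sum_card_powerset {V : Type*} [DecidableEq V] (s : Finset V) :
    2 * ∑ x ∈ s.powerset, (x.card : ℚ) = 2 ^ s.card * s.card := by
  have h : ∑ x ∈ s.powerset, (x.card : ℚ) = ∑ x ∈ s.powerset, ((s.card : ℚ) - x.card) := by
    refine Finset.sum_nbij' (s \ ·) (s \ ·) (by simp) (by simp) ?_ ?_ ?_
    · intro x hx
      exact Finset.sdiff_sdiff_eq_self (Finset.mem_powerset.1 hx)
    · intro x hx
      exact Finset.sdiff_sdiff_eq_self (Finset.mem_powerset.1 hx)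
    · intro x hx
      rw [Finset.cast_card_sdiff (Finset.mem_powerset.1 hx)]
      ring
  rw [Finset.sum_sub_distrib, Finset.sum_const, Finset.card_powerset, nsmul_eq_mul] at h
  push_cast at h
  linarith

theorem dimPlus_nonempty_powerset {V : Type*} [DecidableEq V] (s : Finset V) :
    DimPlus (s.powerset.filter fun x => x.Nonempty) = (s.card : ℚ) / 2 := by
  have he : s.powerset.filter (fun x => x.Nonempty) = s.powerset.erase ∅ := by
    ext x
    simp [Finset.nonempty_iff_ne_empty, and_comm]
  have hmem : ∅ ∈ s.powerset := Finset.empty_mem_powerset s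
  have hcard : ((s.powerset.erase ∅).card : ℚ) + 1 = 2 ^ s.card := by
    exact_mod_cast (Finset.card_erase_add_one hmem).trans (Finset.card_powerset s)
  have hsum : ∑ x ∈ s.powerset.erase ∅, (x.card : ℚ) = ∑ x ∈ s.powerset, (x.card : ℚ) :=
    Finset.sum_erase _ (by simp)
  rw [DimPlus, he, hcard, hsum, div_eq_div_iff (by positivity) two_ne_zero]
  linear_combination two_mul_sum_card_powerset s

theorem indDim_nonempty_powerset {V : Type*} [DecidableEq V] (s : Finset V) :
    indDim (s.powerset.filter fun x => x.Nonempty) = (s.card : ℚ) - 1 := by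
  have he : s.powerset.filter (fun x => x.Nonempty) = Finset.Ioc ∅ s := by
    ext x
    simp [Finset.empty_ssubset, and_comm]
  rw [he, indDim_Ioc (Finset.empty_subset s)]
  simp

/-- For `n ≥ 1`, the complete complex `K_n` (all nonempty subsets of a fixed
`n`-element set) satisfies `Dim⁺(K_n) = n/2` and `dim(K_n) = n - 1`; in
particular `Dim⁺(K_n) = (dim(K_n)+1)/2`. -/
theorem completeComplex_dims {V : Type*} [DecidableEq V] (n : ℕ) (hn : 1 ≤ n)
    (s : Finset V) (hs : s.card = n) :
    DimPlus (s.powerset.filter fun x => x.Nonempty) = (n : ℚ) / 2 ∧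
    indDim (s.powerset.filter fun x => x.Nonempty) = (n : ℚ) - 1 ∧
    DimPlus (s.powerset.filter fun x => x.Nonempty)
      = (indDim (s.powerset.filter fun x => x.Nonempty) + 1) / 2 := by
  subst hs
  rw [dimPlus_nonempty_powerset, indDim_nonempty_powerset]
  exact ⟨rfl, rfl, by ring⟩
end

section
/- If a nonempty finite abstract simplicial complex G satisfies Dim⁺(G) = (dim(G)+1)/2, then G is a complete complex, i.e., G consists of all nonempty subsets of some finite nonempty set. -/
section

open Finset

/-- If all cardinalities of members of `H` lie in `T`, then `dim H ≤ |T| - 1`. -/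
theorem indDim_add_one_le_card {V : Type*} [DecidableEq V] (T : Finset ℕ) :
    ∀ H : Finset (Finset V), (∀ x ∈ H, #x ∈ T) → indDim H + 1 ≤ #T := by
  induction hn : #T generalizing T with
  | zero =>
    intro H hH
    have hH' : H = ∅ := by
      refine eq_empty_of_forall_notMem fun x hx => ?_
      have := hH x hx
      simp [card_eq_zero.1 hn] at this
    subst hH'
    rw [indDim]
    simp
  | succ n ih =>
    intro H hH
    rw [indDim]
    split_ifs with hne
    · have hpos : (0 : ℚ) < #H := by exact_mod_cast hne.card_pos
      have hsum : ∑ x ∈ H.attach, indDim (sphere H x.1) ≤ ∑ _x ∈ H.attach, ((n : ℚ) - 1) := by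
        refine sum_le_sum fun x _ => ?_
        have hcard : #(T.erase #x.1) = n := by
          rw [card_erase_of_mem (hH _ x.2), hn, Nat.add_sub_cancel]
        have := ih (T.erase #x.1) hcard (sphere H x.1) fun y hy => by
          rw [sphere, mem_filter] at hy
          refine mem_erase.2 ⟨?_, hH y hy.1⟩
          rcases hy.2 with h | h
          · exact (card_lt_card h).ne
          · exact (card_lt_card h).ne'
        linarith
      rw [sum_const, card_attach, nsmul_eq_mul] at hsum
      have : (∑ x ∈ H.attach, indDim (sphere H x.1)) / #H ≤ (n : ℚ) - 1 := by
        rw [div_le_iff₀ hpos]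
        linarith
      push_cast
      linarith
    · push_cast
      have : (0 : ℚ) ≤ n := n.cast_nonneg
      linarith

/-- The vertex set of a collection of sets. -/
def vertexSet {V : Type*} [DecidableEq V] (G : Finset (Finset V)) : Finset V :=
  G.biUnion id

/-- The vertices of the link of `x` in `G`. -/
def linkVertices {V : Type*} [DecidableEq V] (G : Finset (Finset V)) (x : Finset V) : Finset V :=
  (vertexSet G).filter fun w => w ∉ x ∧ insert w x ∈ G

/-- The members of `G` lying in the link of the vertex `w`. -/
def vertexLink {V : Type*} [DecidableEq V] (G : Finset (Finset V)) (w : V) : Finset (Finset V) :=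
  G.filter fun x => w ∉ x ∧ insert w x ∈ G

theorem indDim_sphere_le {V : Type*} [DecidableEq V] {G : Finset (Finset V)}
    (hG : IsComplex G) {x : Finset V} (hx : x ∈ G) :
    indDim (sphere G x) ≤ (#x : ℚ) + #(linkVertices G x) - 2 := by
  have hx0 : 0 < #x := (hG.1 x hx).card_pos
  have key := indDim_add_one_le_card ((Icc 1 (#x + #(linkVertices G x))).erase #x)
    (sphere G x) fun y hy => by
      rw [sphere, mem_filter] at hy
      obtain ⟨hyG, hy⟩ := hy
      have hy0 : 0 < #y := (hG.1 y hyG).card_pos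
      rw [mem_erase, mem_Icc]
      rcases hy with h | h
      · have := card_lt_card h
        omega
      · have hlt := card_lt_card h
        have hsub : y \ x ⊆ linkVertices G x := fun w hw => by
          rw [mem_sdiff] at hw
          refine mem_filter.2 ⟨mem_biUnion.2 ⟨y, hyG, hw.1⟩, hw.2, ?_⟩
          exact hG.2 y hyG _ (insert_subset hw.1 h.subset) (insert_nonempty _ _)
        have h1 := card_le_card hsub
        rw [card_sdiff_of_subset h.subset] at h1
        omega
  rw [card_erase_of_mem (mem_Icc.2 ⟨hx0, Nat.le_add_right _ _⟩), Nat.card_Icc,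
    Nat.add_sub_cancel, Nat.cast_sub (by omega)] at key
  push_cast at key
  linarith

/-- `|G| (dim G + 1)` is at most the sum of `|x|` plus the size of the link's vertex set. -/
theorem card_mul_indDim_add_one_le {V : Type*} [DecidableEq V] {G : Finset (Finset V)}
    (hG : IsComplex G) (hne : G.Nonempty) :
    (#G : ℚ) * (indDim G + 1) ≤ ∑ x ∈ G, (#x : ℚ) + ∑ x ∈ G, (#(linkVertices G x) : ℚ) := by
  have hpos : (0 : ℚ) < #G := by exact_mod_cast hne.card_pos
  rw [indDim, if_pos hne, sum_attach G fun x => indDim (sphere G x)]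
  have hsum := sum_le_sum fun x (hx : x ∈ G) => indDim_sphere_le hG hx
  rw [sum_sub_distrib, sum_add_distrib, sum_const, nsmul_eq_mul] at hsum
  have : (#G : ℚ) * (1 + (∑ x ∈ G, indDim (sphere G x)) / #G + 1)
      = 2 * #G + ∑ x ∈ G, indDim (sphere G x) := by
    field_simp
    ring
  linarith

theorem sum_card_eq_sum_vertexSet {V : Type*} [DecidableEq V] (G : Finset (Finset V)) :
    ∑ x ∈ G, #x = ∑ w ∈ vertexSet G, #(G.filter fun y => w ∈ y) := by
  refine Eq.trans (sum_congr rfl fun x hx => congrArg card ?_)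
    (sum_card_bipartiteAbove_eq_sum_card_bipartiteBelow (fun x w => w ∈ x))
  ext w
  simp only [bipartiteAbove, mem_filter, vertexSet, mem_biUnion, id]
  exact ⟨fun h => ⟨⟨x, hx, h⟩, h⟩, fun h => h.2⟩

theorem sum_card_linkVertices {V : Type*} [DecidableEq V] (G : Finset (Finset V)) :
    ∑ x ∈ G, #(linkVertices G x) = ∑ w ∈ vertexSet G, #(vertexLink G w) :=
  sum_card_bipartiteAbove_eq_sum_card_bipartiteBelow (fun x w => w ∉ x ∧ insert w x ∈ G)

theorem card_filter_mem_eq {V : Type*} [DecidableEq V] {G : Finset (Finset V)}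
    (hG : IsComplex G) {w : V} (hw : w ∈ vertexSet G) :
    #(G.filter fun y => w ∈ y) = #(vertexLink G w) + 1 := by
  have hmem {x : Finset V} (hx : x ∈ vertexLink G w) : x ∈ G ∧ w ∉ x ∧ insert w x ∈ G :=
    mem_filter.1 hx
  obtain ⟨z, hz, hwz⟩ := mem_biUnion.1 hw
  have hsing : {w} ∈ G := hG.2 z hz _ (singleton_subset_iff.2 hwz) (singleton_nonempty w)
  have himg : (G.filter fun y => w ∈ y) = insert {w} ((vertexLink G w).image (insert w)) := by
    ext y
    rw [mem_insert, mem_image, mem_filter]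
    constructor
    · rintro ⟨hy, hwy⟩
      rcases (y.erase w).eq_empty_or_nonempty with h | h
      · left
        rw [← insert_erase hwy, h]
        rfl
      · refine Or.inr ⟨y.erase w, mem_filter.2 ⟨hG.2 y hy _ (erase_subset _ _) h,
          notMem_erase _ _, ?_⟩, insert_erase hwy⟩
        rwa [insert_erase hwy]
    · rintro (rfl | ⟨x, hx, rfl⟩)
      · exact ⟨hsing, mem_singleton_self w⟩
      · exact ⟨(hmem hx).2.2, mem_insert_self _ _⟩
  rw [himg, card_insert_of_notMem, card_image_of_injOn]
  · intro x hx y hy hxy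
    have hxy : insert w x = insert w y := hxy
    rw [← erase_insert (hmem hx).2.1, hxy, erase_insert (hmem hy).2.1]
  · rw [mem_image]
    rintro ⟨x, hx, h⟩
    obtain ⟨a, ha⟩ := hG.1 x (hmem hx).1
    have : a ∈ ({w} : Finset V) := h ▸ mem_insert_of_mem ha
    rw [mem_singleton] at this
    exact (hmem hx).2.1 (this ▸ ha)

theorem vertexLink_subset {V : Type*} [DecidableEq V] (G : Finset (Finset V)) (w : V) :
    vertexLink G w ⊆ G.filter fun x => w ∉ x :=
  monotone_filter_right G fun _ _ h => h.1

theorem two_mul_card_filter_mem_le {V : Type*} [DecidableEq V] {G : Finset (Finset V)}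
    (hG : IsComplex G) {w : V} (hw : w ∈ vertexSet G) :
    2 * #(G.filter fun y => w ∈ y) ≤ #G + 1 := by
  have h1 := card_filter_mem_eq hG hw
  have h2 := card_le_card (vertexLink_subset G w)
  have h3 := card_filter_add_card_filter_not (s := G) (fun y => w ∈ y)
  omega

theorem insert_mem_of_two_mul_card_eq {V : Type*} [DecidableEq V] {G : Finset (Finset V)}
    (hG : IsComplex G) {w : V} (hw : w ∈ vertexSet G)
    (h : 2 * #(G.filter fun y => w ∈ y) = #G + 1) {x : Finset V} (hx : x ∈ G) (hwx : w ∉ x) :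
    insert w x ∈ G := by
  have h1 := card_filter_mem_eq hG hw
  have h3 := card_filter_add_card_filter_not (s := G) (fun y => w ∈ y)
  have heq := eq_of_subset_of_card_le (vertexLink_subset G w) (by omega)
  have : x ∈ vertexLink G w := heq ▸ mem_filter.2 ⟨hx, hwx⟩
  exact (mem_filter.1 this).2.2

/-- A complex closed under adding any of its vertices is complete. -/
theorem eq_complete_of_insert_mem {V : Type*} [DecidableEq V] {G : Finset (Finset V)}
    (hG : IsComplex G) (hne : G.Nonempty)
    (h : ∀ w ∈ vertexSet G, ∀ x ∈ G, w ∉ x → insert w x ∈ G) :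
    ∃ s : Finset V, s.Nonempty ∧ G = s.powerset.filter fun x => x.Nonempty := by
  obtain ⟨s, hs, hmax⟩ := exists_max_image G card hne
  refine ⟨s, hG.1 s hs, ?_⟩
  ext y
  rw [mem_filter, mem_powerset]
  refine ⟨fun hy => ⟨fun w hw => ?_, hG.1 y hy⟩, fun hy => hG.2 s hs y hy.1 hy.2⟩
  by_contra hws
  have := hmax _ (h w (mem_biUnion.2 ⟨y, hy, hw⟩) s hs hws)
  rw [card_insert_of_notMem hws] at this
  omega

end

/-- If a nonempty finite abstract simplicial complex `G` satisfies
`Dim⁺(G) = (dim(G)+1)/2`, then `G` is a complete complex: it consists of all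
nonempty subsets of some finite nonempty set. -/
theorem eq_complete_of_DimPlus_eq {V : Type*} [DecidableEq V] (G : Finset (Finset V))
    (hG : IsComplex G) (hne : G.Nonempty)
    (h : DimPlus G = (indDim G + 1) / 2) :
    ∃ s : Finset V, s.Nonempty ∧ G = s.powerset.filter fun x => x.Nonempty := by
  refine eq_complete_of_insert_mem hG hne fun w hw x hx hwx =>
    insert_mem_of_two_mul_card_eq hG hw ?_ hx hwx
  have hdim := card_mul_indDim_add_one_le hG hne
  have hlink : ∑ x ∈ G, x.card = ∑ x ∈ G, (linkVertices G x).card + (vertexSet G).card := by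
    rw [sum_card_eq_sum_vertexSet, sum_card_linkVertices, Finset.card_eq_sum_ones,
      ← Finset.sum_add_distrib]
    exact Finset.sum_congr rfl fun v hv => card_filter_mem_eq hG hv
  have hle : (vertexSet G).card * (G.card + 1) ≤ 2 * ∑ x ∈ G, x.card := by
    have hlink' : ∑ x ∈ G, (x.card : ℚ)
        = ∑ x ∈ G, ((linkVertices G x).card : ℚ) + (vertexSet G).card := by
      exact_mod_cast hlink
    have hpos : (0 : ℚ) < G.card + 1 := by positivity
    rw [DimPlus, div_eq_iff hpos.ne'] at h
    have hmul := mul_le_mul_of_nonneg_right hdim hpos.le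
    have : ((vertexSet G).card : ℚ) * (G.card + 1) ≤ 2 * ∑ x ∈ G, (x.card : ℚ) := by
      have h' : (G.card : ℚ) * (indDim G + 1) * (G.card + 1)
          = 2 * G.card * ∑ x ∈ G, (x.card : ℚ) := by
        rw [h]
        ring
      rw [h', show ∑ x ∈ G, ((linkVertices G x).card : ℚ)
        = ∑ x ∈ G, (x.card : ℚ) - (vertexSet G).card by linarith] at hmul
      linarith
    exact_mod_cast this
  rw [sum_card_eq_sum_vertexSet, Finset.mul_sum, ← smul_eq_mul (vertexSet G).card,
    ← Finset.sum_const] at hle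
  have hbound := fun v (hv : v ∈ vertexSet G) => two_mul_card_filter_mem_le hG hv
  exact (Finset.sum_eq_sum_iff_of_le hbound).1 (le_antisymm (Finset.sum_le_sum hbound) hle) w hw
end

section
/- Let G be a finite abstract simplicial complex and G_1 its Barycentric refinement. For every i ≥ 0, the number of sets of cardinality i+1 in G_1 equals Σ_{j ≥ i} s(j+1, i+1)·v_j(G), where v_j(G) is the number of sets of cardinality j+1 in G and s(m, k) denotes the number of surjective functions from an m-element set onto a k-element set (so s(m,k) = k!·Stirling2(m,k)). -/
/-- The number of surjective functions from an `m`-element set onto a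
`k`-element set. -/
def surjCount (m k : ℕ) : ℕ :=
  Fintype.card {f : Fin m → Fin k // Function.Surjective f}

/-- The Barycentric refinement of `G`: its simplices are the nonempty sets of
simplices of `G` whose elements are pairwise comparable by inclusion. -/
def bary {V : Type*} [DecidableEq V] (G : Finset (Finset V)) :
    Finset (Finset (Finset V)) :=
  G.powerset.filter fun A => A.Nonempty ∧ ∀ x ∈ A, ∀ y ∈ A, x ⊆ y ∨ y ⊆ x

/-- The `t`-th sublevel set of a function on a finset `x`, as a finset of the ambient type. -/
def sublevel {V : Type*} {x : Finset V} {k : ℕ} (f : x → Fin k) (t : Fin k) : Finset V :=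
  (Finset.univ.filter fun u => f u ≤ t).map (Function.Embedding.subtype _)

theorem mem_sublevel {V : Type*} {x : Finset V} {k : ℕ} {f : x → Fin k} {t : Fin k} {v : V} :
    v ∈ sublevel f t ↔ ∃ h : v ∈ x, f ⟨v, h⟩ ≤ t := by
  simp [sublevel]

theorem coe_mem_sublevel {V : Type*} {x : Finset V} {k : ℕ} {f : x → Fin k} {t : Fin k} {u : x} :
    (u : V) ∈ sublevel f t ↔ f u ≤ t := by
  simp [mem_sublevel]

theorem sublevel_subset {V : Type*} {x : Finset V} {k : ℕ} (f : x → Fin k) (t : Fin k) :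
    sublevel f t ⊆ x := fun _ hv => (mem_sublevel.1 hv).1

theorem sublevel_mono {V : Type*} {x : Finset V} {k : ℕ} (f : x → Fin k) :
    Monotone (sublevel f) := by
  intro s t hst v hv
  obtain ⟨h, hs⟩ := mem_sublevel.1 hv
  exact mem_sublevel.2 ⟨h, hs.trans hst⟩

theorem sublevel_injective {V : Type*} {x : Finset V} {k : ℕ} {f : x → Fin k}
    (hf : Function.Surjective f) : Function.Injective (sublevel f) := by
  have key : ∀ s t, sublevel f s = sublevel f t → s ≤ t := by
    intro s t h
    obtain ⟨u, rfl⟩ := hf s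
    exact coe_mem_sublevel.1 (h ▸ coe_mem_sublevel.2 le_rfl)
  exact fun s t h => le_antisymm (key s t h) (key t s h.symm)

theorem card_image_sublevel_filter_notMem {V : Type*} [DecidableEq V] {x : Finset V} {k : ℕ}
    {f : x → Fin k} (hf : Function.Surjective f) (u : x) :
    ((Finset.univ.image (sublevel f)).filter fun B => (u : V) ∉ B).card = f u := by
  rw [Finset.filter_image, Finset.card_image_of_injective _ (sublevel_injective hf)]
  simp only [coe_mem_sublevel, not_le]
  rw [Finset.filter_gt_eq_Iio, Fin.card_Iio]

theorem card_filter_notMem_le_iff {V : Type*} [DecidableEq V] {A : Finset (Finset V)}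
    (hA : ∀ x ∈ A, ∀ y ∈ A, x ⊆ y ∨ y ⊆ x) {B : Finset V} (hB : B ∈ A) (v : V) :
    (A.filter fun C => v ∉ C).card ≤ (A.filter fun C => C ⊂ B).card ↔ v ∈ B := by
  constructor
  · intro h
    by_contra hv
    refine h.not_gt (Finset.card_lt_card ?_)
    refine Finset.ssubset_iff_of_subset (fun C hC => ?_) |>.2 ⟨B, by simp [hB, hv], by simp⟩
    rw [Finset.mem_filter] at hC ⊢
    exact ⟨hC.1, fun h => hv (hC.2.1 h)⟩
  · intro hv
    refine Finset.card_le_card fun C hC => ?_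
    rw [Finset.mem_filter] at hC ⊢
    refine ⟨hC.1, ?_⟩
    rcases hA C hC.1 B hB with h | h
    · exact h.ssubset_of_not_subset fun h' => hC.2 (h' hv)
    · exact absurd (h hv) hC.2

theorem exists_surjective_image_sublevel_eq {V : Type*} [DecidableEq V] {A : Finset (Finset V)}
    (hA : ∀ x ∈ A, ∀ y ∈ A, x ⊆ y ∨ y ⊆ x) (hne : ∀ x ∈ A, x.Nonempty) {x : Finset V}
    (hx : x ∈ A) (hle : ∀ B ∈ A, B ⊆ x) {k : ℕ} (hk : A.card = k) :
    ∃ f : x → Fin k, Function.Surjective f ∧ Finset.univ.image (sublevel f) = A := by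
  let f : x → Fin k := fun u => ⟨(A.filter fun C => (u : V) ∉ C).card, hk ▸
    Finset.card_lt_card (Finset.filter_ssubset.2 ⟨x, hx, by simp⟩)⟩
  have hsub : A ⊆ Finset.univ.image (sublevel f) := by
    intro B hB
    refine Finset.mem_image.2 ⟨⟨(A.filter fun C => C ⊂ B).card, hk ▸
      Finset.card_lt_card (Finset.filter_ssubset.2 ⟨B, hB, by simp⟩)⟩, Finset.mem_univ _, ?_⟩
    ext v
    simp only [mem_sublevel, f, Fin.mk_le_mk, card_filter_notMem_le_iff hA hB]
    exact ⟨fun h => h.2, fun h => ⟨hle B hB h, h⟩⟩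
  have hle_card : (Finset.univ.image (sublevel f)).card ≤ k :=
    Finset.card_image_le.trans (by simp)
  have heq : A = Finset.univ.image (sublevel f) :=
    Finset.eq_of_subset_of_card_le hsub (hle_card.trans hk.ge)
  have hinj : Function.Injective (sublevel f) := by
    have h : Set.InjOn (sublevel f) (Finset.univ : Finset (Fin k)) :=
      Finset.card_image_iff.1 (by rw [← heq, hk, Finset.card_univ, Fintype.card_fin])
    simpa using h
  refine ⟨f, fun t => ?_, heq.symm⟩
  by_contra! ht
  have hmem : sublevel f t ∈ A := heq ▸ Finset.mem_image_of_mem _ (Finset.mem_univ t)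
  obtain ⟨v, hv⟩ := hne _ hmem
  obtain ⟨hvx, hvt⟩ := mem_sublevel.1 hv
  have hlt := lt_of_le_of_ne hvt (ht _)
  let s : Fin k := ⟨t - 1, by omega⟩
  have hst : sublevel f s = sublevel f t := by
    ext w
    simp only [mem_sublevel]
    refine exists_congr fun hw => ?_
    have := ht ⟨w, hw⟩
    simp only [Fin.le_def, ne_eq, Fin.ext_iff, Fin.lt_def, s] at this hlt ⊢
    omega
  have := congrArg Fin.val (hinj hst)
  simp only [Fin.lt_def, s] at this hlt
  omega

theorem surjCount_eq_card {α : Type*} [Fintype α] [DecidableEq α] {m : ℕ}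
    (hm : Fintype.card α = m) (k : ℕ) :
    surjCount m k = (Finset.univ.filter fun f : α → Fin k => Function.Surjective f).card := by
  rw [surjCount, ← Fintype.card_subtype]
  let e : Fin m ≃ α := (Fintype.equivFinOfCardEq hm).symm
  exact Fintype.card_congr ((e.arrowCongr (Equiv.refl _)).subtypeEquiv fun f => by
    simp [Equiv.arrowCongr])

theorem surjCount_eq_zero {m k : ℕ} (h : m < k) : surjCount m k = 0 := by
  rw [surjCount, Fintype.card_eq_zero_iff]
  refine ⟨fun f => ?_⟩
  have := Fintype.card_le_of_surjective _ f.2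
  simp only [Fintype.card_fin] at this
  omega

theorem sup_id_mem_of_chain {V : Type*} [DecidableEq V] {A : Finset (Finset V)}
    (hne : A.Nonempty) (hA : ∀ x ∈ A, ∀ y ∈ A, x ⊆ y ∨ y ⊆ x) : A.sup id ∈ A := by
  obtain ⟨x, hx⟩ := A.exists_maximal hne
  have : A.sup id = x := le_antisymm
    (Finset.sup_le fun y hy => (hA y hy x hx.1).elim id (hx.2 hy)) (Finset.le_sup (f := id) hx.1)
  exact this ▸ hx.1

theorem card_bary_filter_sup_eq {V : Type*} [DecidableEq V] {G : Finset (Finset V)}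
    (hG : IsComplex G) {x : Finset V} (hx : x ∈ G) (i : ℕ) :
    (((bary G).filter fun A => A.card = i + 1).filter fun A => A.sup id = x).card
      = surjCount x.card (i + 1) := by
  rw [surjCount_eq_card (α := x) (by simp)]
  symm
  refine Finset.card_bij (fun f _ => Finset.univ.image (sublevel f)) ?_ ?_ ?_
  · intro f hf
    have hf : Function.Surjective f := (Finset.mem_filter.1 hf).2
    simp only [bary, Finset.mem_filter, Finset.mem_powerset]
    refine ⟨⟨⟨?_, by simp, ?_⟩, ?_⟩, ?_⟩
    · intro B hB
      obtain ⟨t, -, rfl⟩ := Finset.mem_image.1 hB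
      obtain ⟨u, hu⟩ := hf t
      exact hG.2 x hx _ (sublevel_subset f t) ⟨u, coe_mem_sublevel.2 hu.le⟩
    · intro B hB C hC
      obtain ⟨s, -, rfl⟩ := Finset.mem_image.1 hB
      obtain ⟨t, -, rfl⟩ := Finset.mem_image.1 hC
      exact (le_total s t).imp (fun h => sublevel_mono f h) (fun h => sublevel_mono f h)
    · rw [Finset.card_image_of_injective _ (sublevel_injective hf)]
      simp
    · refine le_antisymm (Finset.sup_le fun B hB => ?_) fun v hv => ?_
      · obtain ⟨t, -, rfl⟩ := Finset.mem_image.1 hB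
        exact sublevel_subset f t
      · exact Finset.mem_sup.2 ⟨_, Finset.mem_image_of_mem _ (Finset.mem_univ (f ⟨v, hv⟩)),
          mem_sublevel.2 ⟨hv, le_rfl⟩⟩
  · intro f hf g hg h
    ext u
    rw [← card_image_sublevel_filter_notMem (Finset.mem_filter.1 hf).2,
      ← card_image_sublevel_filter_notMem (Finset.mem_filter.1 hg).2, h]
  · intro A hA
    simp only [bary, Finset.mem_filter, Finset.mem_powerset] at hA
    obtain ⟨⟨⟨hAG, hne, hchain⟩, hcard⟩, rfl⟩ := hA
    obtain ⟨f, hf, h⟩ := exists_surjective_image_sublevel_eq hchain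
      (fun B hB => hG.1 B (hAG hB)) (sup_id_mem_of_chain hne hchain)
      (fun B hB => Finset.le_sup (f := id) hB) hcard
    exact ⟨f, by simpa using hf, h⟩

/-- The number of sets of cardinality `i+1` in the Barycentric refinement `G₁`
equals `∑_{j ≥ i} s(j+1, i+1) · v_j(G)`, where `v_j(G)` is the number of sets of
cardinality `j+1` in `G` and `s(m,k)` is the number of surjections from an
`m`-set onto a `k`-set. -/
theorem bary_fvector {V : Type*} [DecidableEq V] (G : Finset (Finset V))
    (hG : IsComplex G) (d : ℕ) (hd : ∀ x ∈ G, x.card ≤ d + 1) (i : ℕ) :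
    ((bary G).filter fun A => A.card = i + 1).card
      = ∑ j ∈ Finset.Icc i d, surjCount (j + 1) (i + 1) *
          (G.filter fun x => x.card = j + 1).card := by
  have hmaps : ∀ A ∈ (bary G).filter fun A => A.card = i + 1, A.sup id ∈ G := by
    intro A hA
    simp only [bary, Finset.mem_filter, Finset.mem_powerset] at hA
    exact hA.1.1 (sup_id_mem_of_chain hA.1.2.1 hA.1.2.2)
  rw [Finset.card_eq_sum_card_fiberwise hmaps,
    Finset.sum_congr rfl fun x hx => card_bary_filter_sup_eq hG hx i]
  simp only [Finset.card_filter, Finset.mul_sum]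
  rw [Finset.sum_comm]
  refine Finset.sum_congr rfl fun x hx => ?_
  have hpos := (hG.1 x hx).card_pos
  have hdx := hd x hx
  rcases lt_or_ge x.card (i + 1) with h | h
  · rw [surjCount_eq_zero h, Finset.sum_eq_zero]
    intro j hj
    rw [Finset.mem_Icc] at hj
    rw [if_neg (by omega), mul_zero]
  · rw [Finset.sum_eq_single (x.card - 1)]
    · rw [Nat.sub_add_cancel hpos, if_pos rfl, mul_one]
    · intro j _ hj
      rw [if_neg (by omega), mul_zero]
    · intro hj
      exact absurd (Finset.mem_Icc.2 ⟨by omega, by omega⟩) hj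
end

section
/- For n ≥ 1, let K_{n,n} be the join of two disjoint n-point complexes (each consisting of n singletons and no larger sets). Then Dim⁺(K_{n,n}) = 2n/(n+1), dim(K_{n,n}) = 1, and hence δ(K_{n,n}) = Dim⁺(K_{n,n}) − (dim(K_{n,n})+1)/2 = (n−1)/(n+1). -/
theorem indDim_of_nonempty {V : Type*} [DecidableEq V] {G : Finset (Finset V)}
    (hG : G.Nonempty) {c : ℚ} (h : ∀ x ∈ G, indDim (sphere G x) = c) :
    indDim G = 1 + c := by
  have hcard : (G.card : ℚ) ≠ 0 := Nat.cast_ne_zero.2 hG.card_pos.ne'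
  rw [indDim, if_pos hG, Finset.sum_attach G (fun x => indDim (sphere G x)),
    Finset.sum_congr rfl h, Finset.sum_const, nsmul_eq_mul, mul_div_cancel_left₀ _ hcard]

theorem indDim_of_antichain {V : Type*} [DecidableEq V] {G : Finset (Finset V)}
    (hG : G.Nonempty) (h : ∀ x ∈ G, ∀ y ∈ G, ¬ x ⊂ y) : indDim G = 0 := by
  have hsphere : ∀ x ∈ G, indDim (sphere G x) = -1 := by
    intro x hx
    have hempty : sphere G x = ∅ :=
      Finset.filter_eq_empty_iff.2 fun y hy hxy => hxy.elim (h y hy x hx) (h x hx y hy)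
    rw [hempty, indDim_empty]
  rw [indDim_of_nonempty hG hsphere]
  norm_num

theorem indDim_of_pure_graph {V : Type*} [DecidableEq V] {G : Finset (Finset V)}
    (hG : G.Nonempty) (hcard : ∀ x ∈ G, x.card = 1 ∨ x.card = 2)
    (hsphere : ∀ x ∈ G, (sphere G x).Nonempty) : indDim G = 1 := by
  rw [indDim_of_nonempty hG (c := 0), add_zero]
  refine fun x hx => indDim_of_antichain (hsphere x hx) fun y hy z hz hyz => ?_
  simp only [sphere, Finset.mem_filter] at hy hz
  have hx' := hcard x hx
  have hy' := hcard y hy.1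
  have hz' := hcard z hz.1
  have hlt := Finset.card_lt_card hyz
  rcases hy.2 with h₁ | h₁ <;> rcases hz.2 with h₂ | h₂ <;>
    have h₃ := Finset.card_lt_card h₁ <;> have h₄ := Finset.card_lt_card h₂ <;> omega

theorem mem_joinC_points {V : Type*} [DecidableEq V] {s t : Finset V} {x : Finset V} :
    x ∈ joinC (s.image fun v => {v}) (t.image fun v => {v}) ↔
      (∃ a ∈ s, x = {a}) ∨ (∃ b ∈ t, x = {b}) ∨ ∃ a ∈ s, ∃ b ∈ t, x = {a, b} := by
  simp only [joinC, Finset.mem_union, Finset.mem_image, Finset.mem_product, Prod.exists,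
    Finset.insert_eq]
  constructor
  · rintro ((⟨a, ha, rfl⟩ | ⟨b, hb, rfl⟩) | ⟨_, _, ⟨⟨a, ha, rfl⟩, ⟨b, hb, rfl⟩⟩, rfl⟩)
    · exact Or.inl ⟨a, ha, rfl⟩
    · exact Or.inr (Or.inl ⟨b, hb, rfl⟩)
    · exact Or.inr (Or.inr ⟨a, ha, b, hb, rfl⟩)
  · rintro (⟨a, ha, rfl⟩ | ⟨b, hb, rfl⟩ | ⟨a, ha, b, hb, rfl⟩)
    · exact Or.inl (Or.inl ⟨a, ha, rfl⟩)
    · exact Or.inl (Or.inr ⟨b, hb, rfl⟩)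
    · exact Or.inr ⟨_, _, ⟨⟨a, ha, rfl⟩, ⟨b, hb, rfl⟩⟩, rfl⟩

theorem indDim_joinC_points {V : Type*} [DecidableEq V] {s t : Finset V}
    (hs : s.Nonempty) (ht : t.Nonempty) (hst : Disjoint s t) :
    indDim (joinC (s.image fun v => {v}) (t.image fun v => {v})) = 1 := by
  have hne : ∀ a ∈ s, ∀ b ∈ t, a ≠ b := fun a ha b hb => Finset.disjoint_iff_ne.1 hst a ha b hb
  have hleft : ∀ a ∈ s, ∀ b ∈ t, ({a} : Finset V) ⊂ {a, b} := fun a ha b hb =>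
    Finset.ssubset_iff_subset_ne.2 ⟨by simp, fun h => hne a ha b hb (by
      have hmem : b ∈ ({a} : Finset V) := h ▸ by simp
      exact (Finset.mem_singleton.1 hmem).symm)⟩
  have hright : ∀ a ∈ s, ∀ b ∈ t, ({b} : Finset V) ⊂ {a, b} := fun a ha b hb =>
    Finset.ssubset_iff_subset_ne.2 ⟨by simp, fun h => hne a ha b hb (by
      have hmem : a ∈ ({b} : Finset V) := h ▸ by simp
      exact Finset.mem_singleton.1 hmem)⟩
  obtain ⟨a₀, ha₀⟩ := hs
  obtain ⟨b₀, hb₀⟩ := ht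
  refine indDim_of_pure_graph ⟨{a₀}, mem_joinC_points.2 (Or.inl ⟨a₀, ha₀, rfl⟩)⟩ ?_ ?_ <;>
    intro x hx <;>
    rcases mem_joinC_points.1 hx with ⟨a, ha, rfl⟩ | ⟨b, hb, rfl⟩ | ⟨a, ha, b, hb, rfl⟩
  · exact Or.inl (Finset.card_singleton a)
  · exact Or.inl (Finset.card_singleton b)
  · exact Or.inr (Finset.card_pair (hne a ha b hb))
  · exact ⟨{a, b₀}, Finset.mem_filter.2 ⟨mem_joinC_points.2 (Or.inr (Or.inr
      ⟨a, ha, b₀, hb₀, rfl⟩)), Or.inr (hleft a ha b₀ hb₀)⟩⟩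
  · exact ⟨{a₀, b}, Finset.mem_filter.2 ⟨mem_joinC_points.2 (Or.inr (Or.inr
      ⟨a₀, ha₀, b, hb, rfl⟩)), Or.inr (hright a₀ ha₀ b hb)⟩⟩
  · exact ⟨{a}, Finset.mem_filter.2 ⟨mem_joinC_points.2 (Or.inl ⟨a, ha, rfl⟩),
      Or.inl (hleft a ha b hb)⟩⟩

theorem sum_card_joinC_points {V : Type*} [DecidableEq V] {s t : Finset V}
    (hst : Disjoint s t) (f : ℕ → ℚ) :
    ∑ x ∈ joinC (s.image fun v => {v}) (t.image fun v => {v}), f x.card =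
      (s.card + t.card) * f 1 + s.card * t.card * f 2 := by
  have hne : ∀ a ∈ s, ∀ b ∈ t, a ≠ b := fun a ha b hb => Finset.disjoint_iff_ne.1 hst a ha b hb
  have hjoin : joinC (s.image fun v => {v}) (t.image fun v => {v}) =
      (s ∪ t).image (fun v => ({v} : Finset V)) ∪
        (s ×ˢ t).image (fun p => ({p.1, p.2} : Finset V)) := by
    ext x
    simp only [mem_joinC_points, Finset.mem_union, Finset.mem_image, Finset.mem_product,
      Prod.exists]
    grind
  have hdisj : Disjoint ((s ∪ t).image (fun v => ({v} : Finset V)))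
      ((s ×ˢ t).image (fun p => ({p.1, p.2} : Finset V))) := by
    simp only [Finset.disjoint_left, Finset.mem_image, Finset.mem_product]
    rintro _ ⟨v, -, rfl⟩ ⟨p, ⟨hp₁, hp₂⟩, hp⟩
    have hcard := congrArg Finset.card hp
    rw [Finset.card_pair (hne _ hp₁ _ hp₂), Finset.card_singleton] at hcard
    omega
  have hinj : Set.InjOn (fun p : V × V => ({p.1, p.2} : Finset V)) (s ×ˢ t : Finset (V × V)) := by
    rintro ⟨a, b⟩ hab ⟨c, d⟩ hcd h
    simp only [Finset.coe_product, Set.mem_prod, Finset.mem_coe] at hab hcd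
    have ha : a ∈ ({c, d} : Finset V) := h.subset (by simp)
    have hb : b ∈ ({c, d} : Finset V) := h.subset (by simp)
    simp only [Finset.mem_insert, Finset.mem_singleton] at ha hb
    exact Prod.ext (ha.resolve_right (hne a hab.1 d hcd.2))
      (hb.resolve_left (hne c hcd.1 b hab.2).symm)
  have hpair : ∀ p ∈ s ×ˢ t, f ({p.1, p.2} : Finset V).card = f 2 := fun p hp => by
    rw [Finset.card_pair (hne _ (Finset.mem_product.1 hp).1 _ (Finset.mem_product.1 hp).2)]
  rw [hjoin, Finset.sum_union hdisj, Finset.sum_image Finset.singleton_injective.injOn,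
    Finset.sum_image hinj, Finset.sum_congr rfl hpair]
  simp [Finset.card_union_of_disjoint hst]

/-- The complete bipartite complex `K_{n,n}` (`n ≥ 1`), the join of two disjoint
`n`-point complexes, satisfies `Dim⁺(K_{n,n}) = 2n/(n+1)`, `dim(K_{n,n}) = 1`,
and hence `δ(K_{n,n}) = Dim⁺(K_{n,n}) − (dim(K_{n,n})+1)/2 = (n−1)/(n+1)`. -/
theorem Knn_dims {V : Type*} [DecidableEq V] (n : ℕ) (hn : 1 ≤ n)
    (s t : Finset V) (hs : s.card = n) (ht : t.card = n) (hst : Disjoint s t) :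
    DimPlus (joinC (s.image fun v => {v}) (t.image fun v => {v}))
        = 2 * (n : ℚ) / ((n : ℚ) + 1) ∧
    indDim (joinC (s.image fun v => {v}) (t.image fun v => {v})) = 1 ∧
    DimPlus (joinC (s.image fun v => {v}) (t.image fun v => {v}))
        - (indDim (joinC (s.image fun v => {v}) (t.image fun v => {v})) + 1) / 2
      = ((n : ℚ) - 1) / ((n : ℚ) + 1) := by
  have hsum := sum_card_joinC_points hst (fun k => (k : ℚ))
  have hcard := sum_card_joinC_points hst (fun _ => 1)
  rw [Finset.sum_const, nsmul_eq_mul, mul_one] at hcard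
  have hn' : (n : ℚ) + 1 ≠ 0 := by positivity
  have hden : ((n : ℚ) + n) * 1 + n * n * 1 + 1 ≠ 0 := by positivity
  have hplus : DimPlus (joinC (s.image fun v => {v}) (t.image fun v => {v}))
      = 2 * (n : ℚ) / ((n : ℚ) + 1) := by
    rw [DimPlus, hsum, hcard, hs, ht, div_eq_div_iff hden hn']
    push_cast
    ring
  have hdim := indDim_joinC_points (Finset.card_pos.1 (by omega)) (Finset.card_pos.1 (by omega))
    hst
  refine ⟨hplus, hdim, ?_⟩
  rw [hplus, hdim]
  field_simp
  ring
end

section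
/- For every real number p and every n ≥ 0, the expected inductive dimension d_n(p) of the Erdős–Rényi graph ensemble satisfies the recursion d_{n+1}(p) = 1 + Σ_{k=0}^{n} C(n,k)·p^k·(1−p)^{n−k}·d_k(p), with initial value d_0(p) = −1, where d_n(p) = Σ_g p^{e(g)}·(1−p)^{n(n−1)/2 − e(g)}·dim(g), the sum ranging over all simple graphs g on a fixed n-element vertex set and e(g) denoting the number of edges of g. -/
/-- The inductive dimension of the subgraph induced by a graph with (Boolean)
adjacency `adj` on a finite vertex set `A`: the empty graph has dimension `-1`,
and otherwise `dim = 1 + (1/|A|)·∑_{v ∈ A} dim(induced graph on the neighbors of v)`. -/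
def gdim {U : Type*} [DecidableEq U] (adj : U → U → Bool) (A : Finset U) : ℚ :=
  if A.Nonempty then
    1 + (∑ v ∈ A.attach, gdim adj (A.filter fun w => w ≠ v.1 ∧ adj v.1 w)) / A.card
  else -1
termination_by A.card
decreasing_by
  refine Finset.card_lt_card ⟨Finset.filter_subset _ _, fun hsub => ?_⟩
  have h := hsub v.2
  simp only [Finset.mem_filter] at h
  exact h.2.1 rfl

/-- The Erdős–Rényi expected inductive dimension
`d_n(p) = ∑_g p^{e(g)}·(1−p)^{n(n−1)/2 − e(g)}·dim(g)`, the sum ranging over all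
simple graphs `g` on the vertex set `Fin n`, each graph being identified with
its edge set, a set of 2-element subsets of `Fin n`. -/
noncomputable def erDim (p : ℝ) (n : ℕ) : ℝ :=
  ∑ E ∈ ((Finset.univ : Finset (Fin n)).powersetCard 2).powerset,
    p ^ E.card * (1 - p) ^ (n * (n - 1) / 2 - E.card) *
      ((gdim (fun v w => decide (({v, w} : Finset (Fin n)) ∈ E)) Finset.univ : ℚ) : ℝ)

open Finset

lemma gdim_eq {U : Type*} [DecidableEq U] (adj : U → U → Bool) {A : Finset U}
    (hA : A.Nonempty) :
    gdim adj A = 1 + (∑ v ∈ A, gdim adj (A.filter fun w => w ≠ v ∧ adj v w)) / A.card := by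
  rw [gdim, if_pos hA, sum_attach A fun v => gdim adj (A.filter fun w => w ≠ v ∧ adj v w)]

lemma gdim_map {U V : Type*} [DecidableEq U] [DecidableEq V] (f : U ↪ V)
    (adj : U → U → Bool) (adj' : V → V → Bool) (A : Finset U)
    (h : ∀ v ∈ A, ∀ w ∈ A, v ≠ w → adj' (f v) (f w) = adj v w) :
    gdim adj' (A.map f) = gdim adj A := by
  induction A using Finset.strongInduction with
  | H A ih =>
    rcases A.eq_empty_or_nonempty with rfl | hA
    · rw [map_empty, gdim, gdim]; simp
    rw [gdim_eq _ hA, gdim_eq _ (hA.map (f := f)), card_map, sum_map]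
    congr 2
    refine sum_congr rfl fun v hv => ?_
    have hlt : (A.filter fun w => w ≠ v ∧ adj v w) ⊂ A :=
      filter_ssubset.2 ⟨v, hv, by simp⟩
    rw [← ih _ hlt fun a ha b hb => h a (hlt.1 ha) b (hlt.1 hb), filter_map]
    congr 2
    refine filter_congr fun w hw => ?_
    simp only [Function.comp_apply, ne_eq, f.injective.eq_iff]
    refine and_congr_right fun hwv => ?_
    rw [h v hv w hw (Ne.symm hwv)]

lemma gdim_congr {U : Type*} [DecidableEq U] (adj adj' : U → U → Bool) (A : Finset U)
    (h : ∀ v ∈ A, ∀ w ∈ A, v ≠ w → adj' v w = adj v w) :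
    gdim adj' A = gdim adj A := by
  simpa using gdim_map (Function.Embedding.refl U) adj adj' A h

/-- The expectation of `f` over the random subset of `S` that contains each element
independently with probability `p`. -/
noncomputable def bernoulliSum {α : Type*} (p : ℝ) (S : Finset α) (f : Finset α → ℝ) : ℝ :=
  ∑ E ∈ S.powerset, p ^ #E * (1 - p) ^ (#S - #E) * f E

section BernoulliSum

variable {α β : Type*} (p : ℝ)

lemma bernoulliSum_congr {S : Finset α} {f g : Finset α → ℝ} (h : ∀ E ⊆ S, f E = g E) :
    bernoulliSum p S f = bernoulliSum p S g :=
  sum_congr rfl fun E hE => by rw [h E (mem_powerset.1 hE)]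

lemma bernoulliSum_empty (f : Finset α → ℝ) : bernoulliSum p ∅ f = f ∅ := by
  simp [bernoulliSum]

lemma bernoulliSum_const (S : Finset α) (c : ℝ) : bernoulliSum p S (fun _ => c) = c := by
  rw [bernoulliSum, ← sum_mul, sum_pow_mul_eq_add_pow]
  simp

lemma bernoulliSum_add (S : Finset α) (f g : Finset α → ℝ) :
    bernoulliSum p S (fun E => f E + g E) = bernoulliSum p S f + bernoulliSum p S g := by
  simp only [bernoulliSum, mul_add, sum_add_distrib]

lemma bernoulliSum_div (S : Finset α) (f : Finset α → ℝ) (c : ℝ) :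
    bernoulliSum p S (fun E => f E / c) = bernoulliSum p S f / c := by
  simp only [bernoulliSum, sum_div, mul_div_assoc]

lemma bernoulliSum_sum (S : Finset α) (T : Finset β) (f : β → Finset α → ℝ) :
    bernoulliSum p S (fun E => ∑ v ∈ T, f v E) = ∑ v ∈ T, bernoulliSum p S (f v) := by
  simp only [bernoulliSum, mul_sum]
  exact sum_comm

lemma bernoulliSum_insert [DecidableEq α] {S : Finset α} {a : α} (ha : a ∉ S)
    (f : Finset α → ℝ) :
    bernoulliSum p (insert a S) f =
      (1 - p) * bernoulliSum p S f + p * bernoulliSum p S (fun E => f (insert a E)) := by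
  rw [bernoulliSum, sum_powerset_insert ha, bernoulliSum, bernoulliSum, mul_sum, mul_sum]
  congr 1 <;> refine sum_congr rfl fun E hE => ?_
  · rw [card_insert_of_notMem ha,
      Nat.sub_add_comm (card_le_card (mem_powerset.1 hE)), pow_succ]
    ring
  · rw [card_insert_of_notMem ha, card_insert_of_notMem fun h => ha (mem_powerset.1 hE h),
      Nat.add_sub_add_right, pow_succ]
    ring

lemma bernoulliSum_union [DecidableEq α] {S R : Finset α} (h : Disjoint S R)
    (f : Finset α → ℝ) :
    bernoulliSum p (S ∪ R) f =
      bernoulliSum p S (fun E => bernoulliSum p R (fun F => f (E ∪ F))) := by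
  induction S using Finset.induction_on generalizing f with
  | empty => simp [bernoulliSum_empty]
  | insert a S ha ih =>
    rw [disjoint_insert_left] at h
    rw [insert_union, bernoulliSum_insert p (by simp [ha, h.1]), bernoulliSum_insert p ha,
      ih h.2, ih h.2]
    simp only [insert_union]

lemma bernoulliSum_map (S : Finset α) (e : α ↪ β) (f : Finset β → ℝ) :
    bernoulliSum p (S.map e) f = bernoulliSum p S (fun E => f (E.map e)) := by
  classical
  induction S using Finset.induction_on generalizing f with
  | empty => simp [bernoulliSum_empty]
  | insert a S ha ih =>
    rw [map_insert, bernoulliSum_insert p (by simpa using ha), bernoulliSum_insert p ha, ih, ih]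
    simp only [map_insert]

lemma bernoulliSum_marginal [DecidableEq α] {S T : Finset α} (h : S ⊆ T) (f : Finset α → ℝ)
    (hf : ∀ E, f (E ∩ S) = f E) : bernoulliSum p T f = bernoulliSum p S f := by
  rw [← union_sdiff_of_subset h, bernoulliSum_union p disjoint_sdiff]
  refine bernoulliSum_congr p fun E hE => ?_
  rw [bernoulliSum_congr p (g := fun _ => f E), bernoulliSum_const]
  intro F hF
  rw [← hf, union_inter_distrib_right, inter_eq_left.2 hE,
    disjoint_iff_inter_eq_empty.1 (disjoint_sdiff.symm.mono_left hF), union_empty]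

lemma bernoulliSum_card (S : Finset α) (f : ℕ → ℝ) :
    bernoulliSum p S (fun E => f #E) =
      ∑ k ∈ range (#S + 1), ((#S).choose k : ℝ) * p ^ k * (1 - p) ^ (#S - k) * f k := by
  rw [bernoulliSum, sum_powerset_apply_card fun k => p ^ k * (1 - p) ^ (#S - k) * f k]
  exact sum_congr rfl fun k _ => by rw [nsmul_eq_mul]; ring

end BernoulliSum

/-- The inductive dimension of the graph with vertex set `A` and edge set `E`, as a real. -/
noncomputable def edgeDim {U : Type*} [DecidableEq U] (A : Finset U)
    (E : Finset (Finset U)) : ℝ :=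
  ((gdim (fun v w => decide (({v, w} : Finset U) ∈ E)) A : ℚ) : ℝ)

section EdgeDim

variable {U V : Type*} [DecidableEq U] [DecidableEq V]

lemma edgeDim_congr (A : Finset U) {E F : Finset (Finset U)}
    (h : ∀ v ∈ A, ∀ w ∈ A, v ≠ w → (({v, w} : Finset U) ∈ E ↔ ({v, w} : Finset U) ∈ F)) :
    edgeDim A E = edgeDim A F := by
  unfold edgeDim
  rw [gdim_congr]
  exact fun v hv w hw hvw => decide_eq_decide.2 (h v hv w hw hvw)

lemma pair_mem_powersetCard {A : Finset U} {v w : U} (hv : v ∈ A) (hw : w ∈ A) (h : v ≠ w) :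
    ({v, w} : Finset U) ∈ A.powersetCard 2 :=
  mem_powersetCard.2 ⟨by simp [insert_subset_iff, hv, hw], card_pair h⟩

lemma edgeDim_inter (A : Finset U) (E : Finset (Finset U)) :
    edgeDim A (E ∩ A.powersetCard 2) = edgeDim A E :=
  edgeDim_congr A fun v hv w hw h => by
    simp only [mem_inter, pair_mem_powersetCard hv hw h, and_true]

lemma edgeDim_map (A : Finset U) (f : U ↪ V) (E : Finset (Finset U)) :
    edgeDim (A.map f) (E.map (mapEmbedding f).toEmbedding) = edgeDim A E := by
  unfold edgeDim
  rw [gdim_map]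
  refine fun v _ w _ _ => decide_eq_decide.2 ?_
  have : ({f v, f w} : Finset V) = (mapEmbedding f).toEmbedding {v, w} := by simp
  rw [this, mem_map']

lemma erDim_eq_bernoulliSum (p : ℝ) (n : ℕ) :
    erDim p n = bernoulliSum p ((univ : Finset (Fin n)).powersetCard 2) (edgeDim univ) := by
  simp only [erDim, bernoulliSum, edgeDim, card_powersetCard, card_univ, Fintype.card_fin,
    Nat.choose_two_right]

lemma bernoulliSum_edgeDim (p : ℝ) (A : Finset U) :
    bernoulliSum p (A.powersetCard 2) (edgeDim A) = erDim p #A := by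
  have hA : (univ : Finset (Fin #A)).map
      (A.equivFin.symm.toEmbedding.trans (Function.Embedding.subtype _)) = A := by
    rw [← map_map, map_univ_equiv, univ_eq_attach, attach_map_val]
  generalize A.equivFin.symm.toEmbedding.trans (Function.Embedding.subtype _) = e at hA
  rw [erDim_eq_bernoulliSum]
  conv_lhs => rw [← hA]
  rw [powersetCard_map, bernoulliSum_map]
  simp only [edgeDim_map]

/-- Sending `w ≠ v` to the edge `{v, w}` is injective in `w`. -/
def starEmbedding (v : U) : U ↪ Finset U where
  toFun w := {v, w}
  inj' a b h := by
    change ({v, a} : Finset U) = {v, b} at h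
    have ha : a ∈ ({v, b} : Finset U) := h ▸ by simp
    have hb : b ∈ ({v, a} : Finset U) := h ▸ by simp
    simp only [mem_insert, mem_singleton] at ha hb
    grind

@[simp]
lemma starEmbedding_apply (v w : U) : starEmbedding v w = {v, w} := rfl

lemma powersetCard_two_insert {A : Finset U} {v : U} (hv : v ∉ A) :
    (insert v A).powersetCard 2 = A.map (starEmbedding v) ∪ A.powersetCard 2 := by
  rw [powersetCard_succ_insert hv, union_comm, powersetCard_one, map_eq_image, map_eq_image,
    image_image]
  rfl

lemma disjoint_star {A : Finset U} {v : U} (hv : v ∉ A) :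
    Disjoint (A.map (starEmbedding v)) (A.powersetCard 2) := by
  rw [disjoint_left]
  intro s hs hs'
  obtain ⟨w, -, rfl⟩ := mem_map.1 hs
  exact hv ((mem_powersetCard.1 hs').1 (by simp))

lemma bernoulliSum_edgeDim_neighbors (p : ℝ) {A : Finset U} {v : U} (hv : v ∉ A) :
    bernoulliSum p ((insert v A).powersetCard 2)
        (fun E => edgeDim ((insert v A).filter fun w =>
          w ≠ v ∧ decide (({v, w} : Finset U) ∈ E)) E) =
      ∑ k ∈ range (#A + 1), ((#A).choose k : ℝ) * p ^ k * (1 - p) ^ (#A - k) * erDim p k := by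
  rw [powersetCard_two_insert hv, bernoulliSum_union p (disjoint_star hv), bernoulliSum_map,
    ← bernoulliSum_card]
  refine bernoulliSum_congr p fun B hB => ?_
  have hvB : v ∉ B := fun h => hv (hB h)
  rw [← bernoulliSum_edgeDim, ← bernoulliSum_marginal p (powersetCard_mono hB) (edgeDim B)
    (edgeDim_inter B)]
  refine bernoulliSum_congr p fun F hF => ?_
  have hnbr : ((insert v A).filter fun w => w ≠ v ∧
      decide (({v, w} : Finset U) ∈ B.map (starEmbedding v) ∪ F)) = B := by
    ext w
    have hw : ({v, w} : Finset U) ∉ F := fun h =>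
      hv ((mem_powersetCard.1 (hF h)).1 (by simp))
    have hw' : ({v, w} : Finset U) ∈ B.map (starEmbedding v) ↔ w ∈ B :=
      mem_map' (starEmbedding v)
    simp only [mem_filter, mem_insert, decide_eq_true_eq, mem_union, hw, or_false, hw']
    constructor
    · exact fun h => h.2.2
    · exact fun h => ⟨Or.inr (hB h), fun e => hvB (e ▸ h), h⟩
  rw [hnbr]
  refine edgeDim_congr B fun a ha b hb _ => ?_
  rw [mem_union, or_iff_right]
  intro h
  obtain ⟨c, -, hc⟩ := mem_map.1 h
  have : v ∈ ({a, b} : Finset U) := hc ▸ by simp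
  rcases mem_insert.1 this with rfl | h'
  · exact hvB ha
  · exact hvB (mem_singleton.1 h' ▸ hb)

lemma edgeDim_eq {A : Finset U} (hA : A.Nonempty) (E : Finset (Finset U)) :
    edgeDim A E = 1 + (∑ v ∈ A, edgeDim (A.filter fun w =>
      w ≠ v ∧ decide (({v, w} : Finset U) ∈ E)) E) / #A := by
  unfold edgeDim
  rw [gdim_eq _ hA]
  push_cast
  rfl

end EdgeDim

/-- The expected inductive dimension on the Erdős–Rényi ensemble satisfies
`d_{n+1}(p) = 1 + ∑_{k=0}^{n} C(n,k)·p^k·(1−p)^{n−k}·d_k(p)`, with `d_0(p) = −1`. -/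
theorem erDim_recursion (p : ℝ) (n : ℕ) :
    erDim p 0 = -1 ∧
    erDim p (n + 1)
      = 1 + ∑ k ∈ Finset.range (n + 1),
          (n.choose k : ℝ) * p ^ k * (1 - p) ^ (n - k) * erDim p k := by
  refine ⟨?_, ?_⟩
  · have h : (univ : Finset (Fin 0)).powersetCard 2 = ∅ := powersetCard_eq_empty.2 (by simp)
    rw [erDim_eq_bernoulliSum, h, bernoulliSum_empty]
    simp [edgeDim, gdim]
  rw [erDim_eq_bernoulliSum, bernoulliSum_congr p fun E _ => edgeDim_eq univ_nonempty E,
    bernoulliSum_add, bernoulliSum_const, bernoulliSum_div, bernoulliSum_sum]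
  have h : ∀ v : Fin (n + 1), _ := fun v =>
    bernoulliSum_edgeDim_neighbors p (notMem_erase v univ)
  simp only [insert_erase (mem_univ _), card_erase_of_mem (mem_univ _), card_univ,
    Fintype.card_fin, Nat.add_sub_cancel] at h
  rw [sum_congr rfl fun v _ => h v, sum_const, card_univ, Fintype.card_fin, nsmul_eq_mul,
    mul_div_cancel_left₀ _ (by positivity)]
end
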